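/- Every geometric complete multipartite graph H that contains a non-rainbow plane cycle also contains a non-rainbow plane cycle of length 4 or of length 5. -/

import Mathlib

noncomputable section

/-- Points of the plane. -/
abbrev Pt : Type := ℝ × ℝ

/-- Signed side of point `p` with respect to the oriented line through `u` and `u'`
(the usual cross-product / determinant test). -/
def sideSign (u u' p : Pt) : ℝ :=
  (u'.1 - u.1) * (p.2 - u.2) - (u'.2 - u.2) * (p.1 - u.1)

/-- `v` and `v'` lie on strictly opposite sides of the straight line through `u` and `u'`. -/
def StrictlyOppositeSides (u u' v v' : Pt) : Prop :=
  sideSign u u' v * sideSign u u' v' < 0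

/-- A set of points is in general position: no three (distinct) points of it are collinear. -/
def GenPos (P : Set Pt) : Prop :=
  ∀ a ∈ P, ∀ b ∈ P, ∀ c ∈ P, a ≠ b → a ≠ c → b ≠ c →
    ¬ Collinear ℝ ({a, b, c} : Set Pt)

/-- `γ : ZMod t → Pt` is a plane cycle of length `t` for the coloring `φ`:
a cyclic sequence of `t ≥ 3` distinct points in which cyclically consecutive points have
different colors, and in which two distinct edges meet exactly in their common endpoint
if they are cyclically consecutive, and not at all otherwise. -/
def IsPlaneCycle (φ : Pt → ℕ) (t : ℕ) (γ : ZMod t → Pt) : Prop :=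
  3 ≤ t ∧ Function.Injective γ ∧
  (∀ i : ZMod t, φ (γ i) ≠ φ (γ (i + 1))) ∧
  ∀ i j : ZMod t, i ≠ j →
    (j = i + 1 →
      segment ℝ (γ i) (γ (i + 1)) ∩ segment ℝ (γ j) (γ (j + 1)) = ({γ (i + 1)} : Set Pt)) ∧
    (j ≠ i + 1 → i ≠ j + 1 →
      segment ℝ (γ i) (γ (i + 1)) ∩ segment ℝ (γ j) (γ (j + 1)) = (∅ : Set Pt))

/-- A cycle is non-rainbow if some color appears on two of its points. -/
def NonRainbow (φ : Pt → ℕ) (t : ℕ) (γ : ZMod t → Pt) : Prop :=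
  ∃ i j : ZMod t, i ≠ j ∧ φ (γ i) = φ (γ j)

/-- A set of points is in convex position (each point is a vertex of the convex hull). -/
def ConvexPosition (s : Set Pt) : Prop :=
  ∀ p ∈ s, p ∉ convexHull ℝ (s \ {p})

lemma ss_rot (a b c : Pt) : sideSign b c a = sideSign a b c := by
  unfold sideSign; ring

lemma ss_swap (a b c : Pt) : sideSign b a c = - sideSign a b c := by
  unfold sideSign; ring

lemma ss_sum (a b c d : Pt) :
    sideSign a b c = sideSign d a b + sideSign d b c + sideSign d c a := by
  unfold sideSign; ring

lemma ss_collinear (a b c : Pt) (hab : a ≠ b) (h : sideSign a b c = 0) :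
    Collinear ℝ ({a, b, c} : Set Pt) := by
  rw [collinear_iff_of_mem (p₀ := a) (by simp)]
  refine ⟨b - a, ?_⟩
  obtain ⟨a1, a2⟩ := a
  obtain ⟨b1, b2⟩ := b
  obtain ⟨c1, c2⟩ := c
  simp only [sideSign] at h
  intro p hp
  simp only [Set.mem_insert_iff, Set.mem_singleton_iff] at hp
  rcases hp with rfl | rfl | rfl
  · exact ⟨0, by simp⟩
  · exact ⟨1, by simp⟩
  · by_cases h1 : b1 - a1 = 0
    · have h2 : b2 - a2 ≠ 0 := by
        intro h2; apply hab; ext <;> simp <;> linarith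
      refine ⟨(c2 - a2) / (b2 - a2), ?_⟩
      rw [h1] at h
      have h3 : c1 - a1 = 0 := by
        have : (b2 - a2) * (c1 - a1) = 0 := by linarith
        exact (mul_eq_zero.mp this).resolve_left h2
      ext
      · simp [h1]; linarith
      · simp; field_simp; ring
    · refine ⟨(c1 - a1) / (b1 - a1), ?_⟩
      ext
      · simp; field_simp; ring
      · simp; field_simp; linarith

lemma ss_seg (p q x : Pt) (c d : Pt) (u v : ℝ) (huv : u + v = 1) (hx : u • c + v • d = x) :
    sideSign p q x = u * sideSign p q c + v * sideSign p q d := by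
  subst hx
  have : u = 1 - v := by linarith
  subst this
  simp [sideSign]; ring

lemma ss_left (p q : Pt) : sideSign p q p = 0 := by unfold sideSign; ring
lemma ss_right (p q : Pt) : sideSign p q q = 0 := by unfold sideSign; ring

lemma seg_disj (p q c d : Pt) (h : 0 < sideSign p q c * sideSign p q d) :
    segment ℝ p q ∩ segment ℝ c d = (∅ : Set Pt) := by
  rw [Set.eq_empty_iff_forall_notMem]
  rintro x ⟨⟨u, v, hu, hv, huv, hx⟩, ⟨u', v', hu', hv', huv', hx'⟩⟩
  have h1 := ss_seg p q x p q u v huv hx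
  have h2 := ss_seg p q x c d u' v' huv' hx'
  rw [ss_left, ss_right] at h1
  rcases mul_pos_iff.mp h with ⟨ha, hb⟩ | ⟨ha, hb⟩
  · have e1 := mul_nonneg hu' ha.le
    have e2 := mul_nonneg hv' hb.le
    have e3 : u' * sideSign p q c = 0 := by linarith
    have e4 : v' * sideSign p q d = 0 := by linarith
    have e5 := (mul_eq_zero.mp e3).resolve_right ha.ne'
    have e6 := (mul_eq_zero.mp e4).resolve_right hb.ne'
    linarith
  · have e1 := mul_nonpos_of_nonneg_of_nonpos hu' ha.le
    have e2 := mul_nonpos_of_nonneg_of_nonpos hv' hb.le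
    have e3 : u' * sideSign p q c = 0 := by linarith
    have e4 : v' * sideSign p q d = 0 := by linarith
    have e5 := (mul_eq_zero.mp e3).resolve_right ha.ne
    have e6 := (mul_eq_zero.mp e4).resolve_right hb.ne
    linarith

lemma seg_adj (p q c : Pt) (h : sideSign p q c ≠ 0) :
    segment ℝ p q ∩ segment ℝ q c = ({q} : Set Pt) := by
  ext x
  constructor
  · rintro ⟨⟨u, v, hu, hv, huv, hx⟩, ⟨u', v', hu', hv', huv', hx'⟩⟩
    have h1 := ss_seg p q x p q u v huv hx
    have h2 := ss_seg p q x q c u' v' huv' hx'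
    rw [ss_left, ss_right] at h1
    rw [ss_right] at h2
    have e3 : v' * sideSign p q c = 0 := by linarith
    have e5 := (mul_eq_zero.mp e3).resolve_right h
    subst e5
    have : u' = 1 := by linarith
    subst this
    simpa using hx'.symm
  · rintro rfl
    exact ⟨right_mem_segment _ _ _, left_mem_segment _ _ _⟩

lemma seg_cross (p q c d : Pt) (h1 : sideSign p q c * sideSign p q d < 0)
    (h2 : sideSign c d p * sideSign c d q < 0) :
    (segment ℝ p q ∩ segment ℝ c d).Nonempty := by
  have key : ∀ X Y : ℝ, X * Y < 0 → 0 ≤ X / (X - Y) ∧ 0 ≤ - Y / (X - Y) ∧ X - Y ≠ 0 := by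
    intro X Y h
    rcases mul_neg_iff.mp h with ⟨ha, hb⟩ | ⟨ha, hb⟩
    · exact ⟨div_nonneg ha.le (by linarith), div_nonneg (by linarith) (by linarith),
        by intro; linarith⟩
    · exact ⟨div_nonneg_of_nonpos ha.le (by linarith),
        div_nonneg_of_nonpos (by linarith) (by linarith), by intro; linarith⟩
  obtain ⟨k1, k2, k3⟩ := key _ _ h1
  obtain ⟨m1, m2, m3⟩ := key _ _ h2
  refine ⟨(- sideSign c d q / (sideSign c d p - sideSign c d q)) • p +
    (sideSign c d p / (sideSign c d p - sideSign c d q)) • q, ⟨_, _, m2, m1, ?_, rfl⟩,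
    ⟨- sideSign p q d / (sideSign p q c - sideSign p q d),
     sideSign p q c / (sideSign p q c - sideSign p q d), k2, k1, ?_, ?_⟩⟩
  · field_simp; ring
  · field_simp; ring
  · ext
    · simp only [Prod.fst_add, Prod.smul_fst, smul_eq_mul]
      field_simp
      simp only [sideSign]; ring
    · simp only [Prod.snd_add, Prod.smul_snd, smul_eq_mul]
      field_simp
      simp only [sideSign]; ring

lemma gp_ne {P : Set Pt} (hgp : GenPos P) {a b c : Pt} (ha : a ∈ P) (hb : b ∈ P) (hc : c ∈ P)
    (hab : a ≠ b) (hac : a ≠ c) (hbc : b ≠ c) : sideSign a b c ≠ 0 := fun h =>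
  hgp a ha b hb c hc hab hac hbc (ss_collinear a b c hab h)

lemma mk4 {P : Set Pt} (hgp : GenPos P) (φ : Pt → ℕ) (a b c d : Pt)
    (ha : a ∈ P) (hb : b ∈ P) (hc : c ∈ P) (hd : d ∈ P)
    (hab : φ a ≠ φ b) (hbc : φ b ≠ φ c) (hcd : φ c ≠ φ d) (hda : φ d ≠ φ a)
    (hac : a ≠ c) (hbd : b ≠ d) (hn : φ a = φ c)
    (h1 : segment ℝ a b ∩ segment ℝ c d = (∅ : Set Pt))
    (h2 : segment ℝ b c ∩ segment ℝ d a = (∅ : Set Pt)) :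
    ∃ γ : ZMod 4 → Pt, IsPlaneCycle φ 4 γ ∧ (∀ i, γ i ∈ P) ∧ NonRainbow φ 4 γ := by
  have nab : a ≠ b := fun h => hab (by rw [h])
  have nbc : b ≠ c := fun h => hbc (by rw [h])
  have ncd : c ≠ d := fun h => hcd (by rw [h])
  have nda : d ≠ a := fun h => hda (by rw [h])
  have s1 := seg_adj a b c (gp_ne hgp ha hb hc nab hac nbc)
  have s2 := seg_adj b c d (gp_ne hgp hb hc hd nbc hbd ncd)
  have s3 := seg_adj c d a (gp_ne hgp hc hd ha ncd hac.symm nda)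
  have s4 := seg_adj d a b (gp_ne hgp hd ha hb nda hbd.symm nab)
  have h1' := h1; rw [Set.inter_comm] at h1'
  have h2' := h2; rw [Set.inter_comm] at h2'
  let γ : ZMod 4 → Pt := (![a, b, c, d] : Fin 4 → Pt)
  have g0 : γ 0 = a := rfl
  have g1 : γ 1 = b := rfl
  have g2 : γ 2 = c := rfl
  have g3 : γ 3 = d := rfl
  have all : ∀ i : ZMod 4, i = 0 ∨ i = 1 ∨ i = 2 ∨ i = 3 := by decide
  have e1 : (0 : ZMod 4) + 1 = 1 := by decide
  have e2 : (1 : ZMod 4) + 1 = 2 := by decide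
  have e3 : (2 : ZMod 4) + 1 = 3 := by decide
  have e4 : (3 : ZMod 4) + 1 = 0 := by decide
  refine ⟨γ, ⟨by norm_num, ?_, ?_, ?_⟩, ?_, 0, 2, by decide, hn⟩
  · intro i j hij
    rcases all i with rfl | rfl | rfl | rfl <;> rcases all j with rfl | rfl | rfl | rfl <;>
      simp only [g0, g1, g2, g3] at hij <;> first | rfl | (exfalso; simp_all)
  · intro i
    rcases all i with rfl | rfl | rfl | rfl <;> simp only [e1, e2, e3, e4, g0, g1, g2, g3] <;>
      assumption
  · intro i j hij
    rcases all i with rfl | rfl | rfl | rfl <;> rcases all j with rfl | rfl | rfl | rfl <;>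
      simp only [e1, e2, e3, e4, g0, g1, g2, g3] <;>
      refine ⟨fun h => ?_, fun h h' => ?_⟩ <;>
      first | assumption | exact absurd h (by decide) | exact absurd h' (by decide) | exact absurd rfl hij | exact absurd rfl h | exact absurd rfl h'
  · intro i
    rcases all i with rfl | rfl | rfl | rfl <;> simp only [g0, g1, g2, g3] <;> assumption

lemma mk5 {P : Set Pt} (hgp : GenPos P) (φ : Pt → ℕ) (a b c d e : Pt)
    (ha : a ∈ P) (hb : b ∈ P) (hc : c ∈ P) (hd : d ∈ P) (he : e ∈ P)
    (hab : φ a ≠ φ b) (hbc : φ b ≠ φ c) (hcd : φ c ≠ φ d) (hde : φ d ≠ φ e) (hea : φ e ≠ φ a)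
    (hac : a ≠ c) (hbd : b ≠ d) (hce : c ≠ e) (hda : d ≠ a) (heb : e ≠ b) (hn : φ a = φ c)
    (h1 : segment ℝ a b ∩ segment ℝ c d = (∅ : Set Pt))
    (h2 : segment ℝ b c ∩ segment ℝ d e = (∅ : Set Pt))
    (h3 : segment ℝ c d ∩ segment ℝ e a = (∅ : Set Pt))
    (h4 : segment ℝ d e ∩ segment ℝ a b = (∅ : Set Pt))
    (h5 : segment ℝ e a ∩ segment ℝ b c = (∅ : Set Pt)) :
    ∃ γ : ZMod 5 → Pt, IsPlaneCycle φ 5 γ ∧ (∀ i, γ i ∈ P) ∧ NonRainbow φ 5 γ := by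
  have nab : a ≠ b := fun h => hab (by rw [h])
  have nbc : b ≠ c := fun h => hbc (by rw [h])
  have ncd : c ≠ d := fun h => hcd (by rw [h])
  have nde : d ≠ e := fun h => hde (by rw [h])
  have nea : e ≠ a := fun h => hea (by rw [h])
  have s1 := seg_adj a b c (gp_ne hgp ha hb hc nab hac nbc)
  have s2 := seg_adj b c d (gp_ne hgp hb hc hd nbc hbd ncd)
  have s3 := seg_adj c d e (gp_ne hgp hc hd he ncd hce nde)
  have s4 := seg_adj d e a (gp_ne hgp hd he ha nde hda nea)
  have s5 := seg_adj e a b (gp_ne hgp he ha hb nea heb nab)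
  have h1' := h1; rw [Set.inter_comm] at h1'
  have h2' := h2; rw [Set.inter_comm] at h2'
  have h3' := h3; rw [Set.inter_comm] at h3'
  have h4' := h4; rw [Set.inter_comm] at h4'
  have h5' := h5; rw [Set.inter_comm] at h5'
  let γ : ZMod 5 → Pt := (![a, b, c, d, e] : Fin 5 → Pt)
  have g0 : γ 0 = a := rfl
  have g1 : γ 1 = b := rfl
  have g2 : γ 2 = c := rfl
  have g3 : γ 3 = d := rfl
  have g4 : γ 4 = e := rfl
  have all : ∀ i : ZMod 5, i = 0 ∨ i = 1 ∨ i = 2 ∨ i = 3 ∨ i = 4 := by decide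
  have e1 : (0 : ZMod 5) + 1 = 1 := by decide
  have e2 : (1 : ZMod 5) + 1 = 2 := by decide
  have e3 : (2 : ZMod 5) + 1 = 3 := by decide
  have e4 : (3 : ZMod 5) + 1 = 4 := by decide
  have e5 : (4 : ZMod 5) + 1 = 0 := by decide
  refine ⟨γ, ⟨by norm_num, ?_, ?_, ?_⟩, ?_, 0, 2, by decide, hn⟩
  · intro i j hij
    rcases all i with rfl | rfl | rfl | rfl | rfl <;>
      rcases all j with rfl | rfl | rfl | rfl | rfl <;>
      simp only [g0, g1, g2, g3, g4] at hij <;>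
      first | rfl | exact absurd hij (by assumption) | exact absurd hij.symm (by assumption)
  · intro i
    rcases all i with rfl | rfl | rfl | rfl | rfl <;>
      simp only [e1, e2, e3, e4, e5, g0, g1, g2, g3, g4] <;>
      assumption
  · intro i j hij
    rcases all i with rfl | rfl | rfl | rfl | rfl <;>
      rcases all j with rfl | rfl | rfl | rfl | rfl <;>
      simp only [e1, e2, e3, e4, e5, g0, g1, g2, g3, g4] <;>
      refine ⟨fun h => ?_, fun h h' => ?_⟩ <;>
      first | assumption | exact absurd h (by decide) | exact absurd h' (by decide) | exact absurd rfl hij | exact absurd rfl h | exact absurd rfl h'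
  · intro i
    rcases all i with rfl | rfl | rfl | rfl | rfl <;> simp only [g0, g1, g2, g3, g4] <;> assumption

/-- If the segments `ab` and `a'c` meet, the four points are in convex position with side `aa'`. -/
lemma cross_avoid {P : Set Pt} (hgp : GenPos P) {a a' b c : Pt}
    (ha : a ∈ P) (ha' : a' ∈ P) (hb : b ∈ P) (hc : c ∈ P)
    (haa : a ≠ a') (hbc : b ≠ c) (hab : a ≠ b) (hac : a ≠ c) (hab' : a' ≠ b) (hac' : a' ≠ c)
    (h : segment ℝ a b ∩ segment ℝ a' c ≠ (∅ : Set Pt)) :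
    0 < sideSign a a' b * sideSign a a' c ∧ 0 < sideSign b c a * sideSign b c a' := by
  have h1 : sideSign a b a' * sideSign a b c ≤ 0 := by
    by_contra hh; exact h (seg_disj _ _ _ _ (not_le.mp hh))
  have h2 : sideSign a' c a * sideSign a' c b ≤ 0 := by
    by_contra hh
    exact h (by rw [Set.inter_comm]; exact seg_disj _ _ _ _ (not_le.mp hh))
  have n1 := gp_ne hgp ha ha' hb haa hab hab'
  have n2 := gp_ne hgp ha ha' hc haa hac hac'
  have n3 := gp_ne hgp ha hb hc hab hac hbc
  have n4 := gp_ne hgp ha' hb hc hab' hac' hbc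
  have id := ss_sum a b c a'
  have r1 : sideSign a b a' = - sideSign a a' b := by unfold sideSign; ring
  have r2 : sideSign a' c a = sideSign a a' c := by unfold sideSign; ring
  have r3 : sideSign a' c b = - sideSign a' b c := by unfold sideSign; ring
  have r4 : sideSign a' a b = - sideSign a a' b := by unfold sideSign; ring
  have r5 : sideSign b c a = sideSign a b c := by unfold sideSign; ring
  have r6 : sideSign b c a' = sideSign a' b c := by unfold sideSign; ring
  rw [r1] at h1
  rw [r2, r3] at h2
  rw [r4, r2] at id
  rw [r5, r6]
  generalize sideSign a a' b = X at *
  generalize sideSign a a' c = Y at *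
  generalize sideSign a b c = Z at *
  generalize sideSign a' b c = W at *
  have h1' : 0 < X * Z := lt_of_le_of_ne (by linarith) (mul_ne_zero n1 n3).symm
  have h2' : 0 < Y * W := lt_of_le_of_ne (by linarith) (mul_ne_zero n2 n4).symm
  rcases mul_pos_iff.mp h1' with ⟨p, q⟩ | ⟨p, q⟩ <;>
    rcases mul_pos_iff.mp h2' with ⟨p', q'⟩ | ⟨p', q'⟩
  · exact ⟨mul_pos p p', mul_pos q q'⟩
  · linarith
  · linarith
  · exact ⟨mul_pos_of_neg_of_neg p p', mul_pos_of_neg_of_neg q q'⟩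

lemma avoid {P : Set Pt} (hgp : GenPos P) (φ : Pt → ℕ)
    (hno : ¬ ∃ γ : ZMod 4 → Pt, IsPlaneCycle φ 4 γ ∧ (∀ i, γ i ∈ P) ∧ NonRainbow φ 4 γ)
    {a a' b c : Pt} (ha : a ∈ P) (ha' : a' ∈ P) (hb : b ∈ P) (hc : c ∈ P)
    (haa : a ≠ a') (hbc : b ≠ c) (hφ : φ a' = φ a) (hφb : φ b ≠ φ a) (hφc : φ c ≠ φ a) :
    0 < sideSign a a' b * sideSign a a' c ∧ 0 < sideSign b c a * sideSign b c a' := by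
  have hab : a ≠ b := fun h => hφb (by rw [h])
  have hac : a ≠ c := fun h => hφc (by rw [h])
  have hab' : a' ≠ b := fun h => hφb (by rw [← h, hφ])
  have hac' : a' ≠ c := fun h => hφc (by rw [← h, hφ])
  by_cases h1 : segment ℝ a b ∩ segment ℝ a' c = (∅ : Set Pt)
  · by_cases h2 : segment ℝ b a' ∩ segment ℝ c a = (∅ : Set Pt)
    · exact absurd (mk4 hgp φ a b a' c ha hb ha' hc hφb.symm (by rw [hφ]; exact hφb)
        (by rw [hφ]; exact hφc.symm) hφc haa hbc hφ.symm h1 h2) hno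
    · have h3 : segment ℝ a c ∩ segment ℝ a' b ≠ (∅ : Set Pt) := by
        rwa [Set.inter_comm, segment_symm ℝ a c, segment_symm ℝ a' b]
      have := cross_avoid hgp ha ha' hc hb haa hbc.symm hac hab hac' hab' h3
      rw [mul_comm (sideSign a a' b), ss_swap c b a, ss_swap c b a', neg_mul_neg]
      exact this
  · exact cross_avoid hgp ha ha' hb hc haa hbc hab hac hab' hac' h1

lemma reverse_cycle {φ : Pt → ℕ} {t : ℕ} {γ : ZMod t → Pt} (h : IsPlaneCycle φ t γ) :
    IsPlaneCycle φ t (fun i => γ (-i)) := by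
  obtain ⟨h3, hinj, hc, hs⟩ := h
  have e : ∀ i : ZMod t, segment ℝ (γ (-i)) (γ (-(i + 1))) =
      segment ℝ (γ (-i - 1)) (γ (-i - 1 + 1)) := by
    intro i
    rw [segment_symm, show -i - 1 + 1 = -i by ring, show -(i + 1) = -i - 1 by ring]
  refine ⟨h3, fun i j hij => neg_injective (hinj hij), ?_, ?_⟩
  · intro i
    have := hc (-i - 1)
    rw [show -i - 1 + 1 = -i by ring] at this
    show φ (γ (-i)) ≠ φ (γ (-(i + 1)))
    rw [show -(i + 1) = -i - 1 by ring]
    exact this.symm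
  · intro i j hij
    have := hs (-j - 1) (-i - 1) (fun hh => hij (by linear_combination hh))
    simp only [e]
    rw [Set.inter_comm]
    refine ⟨fun hh => ?_, fun h1 h2 => ?_⟩
    · rw [this.1 (by rw [hh]; ring), hh]
      congr 2; ring
    · exact this.2 (fun hh => h1 (by linear_combination hh)) (fun hh => h2 (by linear_combination hh))

lemma core {P : Set Pt} (hgp : GenPos P) (φ : Pt → ℕ)
    (hno : ¬ ∃ γ : ZMod 4 → Pt, IsPlaneCycle φ 4 γ ∧ (∀ i, γ i ∈ P) ∧ NonRainbow φ 4 γ)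
    (t : ℕ) (γ : ZMod t → Pt) (hγ : IsPlaneCycle φ t γ) (hP : ∀ i, γ i ∈ P)
    (i0 m : ZMod t) (hm : m ≠ i0) (hφm : φ (γ m) = φ (γ i0))
    (hpos : ∀ j, j ≠ i0 → φ (γ j) = φ (γ i0) → 0 < sideSign (γ (i0 - 1)) (γ i0) (γ j))
    (hneg : sideSign (γ (i0 - 1)) (γ i0) (γ (i0 + 1)) < 0) :
    ∃ γ : ZMod 5 → Pt, IsPlaneCycle φ 5 γ ∧ (∀ i, γ i ∈ P) ∧ NonRainbow φ 5 γ := by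
  classical
  obtain ⟨ht, hinj, hcol, hseg⟩ := hγ
  haveI : NeZero t := ⟨by omega⟩
  have hr : φ (γ (i0 - 1)) ≠ φ (γ i0) := by
    have := hcol (i0 - 1); rwa [sub_add_cancel] at this
  have hMc : i0 + ((m - i0).val : ZMod t) = m := by rw [ZMod.natCast_zmod_val]; ring
  set M := (m - i0).val with hM
  have hMt : M < t := ZMod.val_lt _
  have hex : ∃ k : ℕ, 0 < sideSign (γ (i0 - 1)) (γ i0) (γ (i0 + (k : ZMod t))) :=
    ⟨M, by rw [hMc]; exact hpos m hm hφm⟩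
  have hspec := Nat.find_spec hex
  have hmin := fun j => @Nat.find_min _ _ hex j
  have hle : Nat.find hex ≤ M := Nat.find_min' hex (by rw [hMc]; exact hpos m hm hφm)
  generalize Nat.find hex = k at hspec hmin hle
  have hk0 : k ≠ 0 := by
    rintro rfl
    simp [ss_right] at hspec
  have hk1 : k ≠ 1 := by
    rintro rfl
    simp at hspec
    linarith
  obtain ⟨j, rfl⟩ : ∃ j, k = j + 1 := ⟨k - 1, by omega⟩
  have hM1 : M + 1 ≠ t := by
    intro hh
    have h1 : ((M + 1 : ℕ) : ZMod t) = 0 := by rw [hh]; simp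
    push_cast at h1
    have h2 : m = i0 - 1 := by rw [← hMc]; linear_combination h1
    rw [h2] at hφm
    exact hr hφm
  have hnz : ∀ s : ℕ, 0 < s → s < t → (s : ZMod t) ≠ 0 := by
    intro s h1 h2 h3
    rw [ZMod.natCast_eq_zero_iff] at h3
    exact absurd (Nat.le_of_dvd h1 h3) (by omega)
  have z1 := hnz 1 (by omega) (by omega)
  have zj := hnz j (by omega) (by omega)
  have zj1 := hnz (j + 1) (by omega) (by omega)
  have zj2 := hnz (j + 2) (by omega) (by omega)
  have hcyc := hcol (i0 + j)
  have hsg := (hseg (i0 - 1) (i0 + j) (fun h => zj1 (by push_cast; linear_combination -h))).2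
    (fun h => zj (by linear_combination h))
    (fun h => zj2 (by push_cast; linear_combination -h))
  rw [sub_add_cancel] at hsg
  have hzneg := hmin j (by omega)
  push_cast at hspec zj1 zj2 z1
  rw [← add_assoc] at hspec
  have dzr : i0 + (j : ZMod t) ≠ i0 - 1 := fun h => zj1 (by linear_combination h)
  have dza : i0 + (j : ZMod t) ≠ i0 := fun h => zj (by linear_combination h)
  have dyr : i0 + (j : ZMod t) + 1 ≠ i0 - 1 := fun h => zj2 (by linear_combination h)
  have dya : i0 + (j : ZMod t) + 1 ≠ i0 := fun h => zj1 (by linear_combination h)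
  have dra : i0 - 1 ≠ i0 := fun h => z1 (by linear_combination -h)
  have hzB : φ (γ (i0 + j)) ≠ φ (γ i0) := fun h => hzneg (hpos _ dza h)
  have hma := hpos m hm hφm
  have pz := hP (i0 + j)
  have py := hP (i0 + j + 1)
  have pr := hP (i0 - 1)
  have pa := hP i0
  have pm := hP m
  have hma' : γ m ≠ γ i0 := fun h => hm (hinj h)
  have dzr := hinj.ne dzr
  have dza := hinj.ne dza
  have dyr := hinj.ne dyr
  have dya := hinj.ne dya
  have dra := hinj.ne dra
  have hyA : φ (γ (i0 + j + 1)) = φ (γ i0) → False := by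
    clear hpos hneg hmin hseg hcol
    generalize γ (i0 + j) = z at *
    generalize γ (i0 + j + 1) = y at *
    generalize γ (i0 - 1) = r at *
    generalize γ i0 = a at *
    intro hy
    have hzn : sideSign r a z < 0 :=
      lt_of_le_of_ne (not_lt.mp hzneg) (gp_ne hgp pr pa pz dra dzr.symm dza.symm)
    obtain ⟨q1, q2⟩ := avoid hgp φ hno pa py pz pr dya.symm dzr hy hzB hr
    have := seg_cross r a z y (mul_neg_of_neg_of_pos hzn hspec) (by
      have r1 : sideSign a y z = - sideSign z y a := by unfold sideSign; ring
      have r2 : sideSign a y r = sideSign r a y := by unfold sideSign; ring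
      have r3 : sideSign z r a = sideSign r a z := by unfold sideSign; ring
      have r4 : sideSign z r y = - sideSign z y r := by unfold sideSign; ring
      rw [r1, r2] at q1
      rw [r3, r4] at q2
      have w1 := (pos_iff_pos_of_mul_pos q1).mpr hspec
      have w2 := (neg_iff_neg_of_mul_pos q2).mp hzn
      exact mul_neg_of_pos_of_neg (by linarith) (by linarith))
    rw [hsg] at this
    exact Set.not_nonempty_empty this
  clear hpos hneg hmin hseg hcol
  have dzy : γ (i0 + j) ≠ γ (i0 + j + 1) := fun h => hcyc (by rw [← h])
  generalize γ (i0 + j) = z at *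
  generalize γ (i0 + j + 1) = y at *
  generalize γ (i0 - 1) = r at *
  generalize γ i0 = a at *
  generalize γ m = a' at *
  have hzn : sideSign r a z < 0 :=
    lt_of_le_of_ne (not_lt.mp hzneg) (gp_ne hgp pr pa pz dra dzr.symm dza.symm)
  have dm : ∀ b, φ b ≠ φ a → a' ≠ b := fun b hb h => hb (by rw [← h, hφm])
  have ay := (avoid hgp φ hno pa pm pr py hma'.symm dyr.symm hφm hr hyA).1
  have az := (avoid hgp φ hno pa pm pr pz hma'.symm dzr.symm hφm hr hzB).1
  have yz := (avoid hgp φ hno pa pm py pz hma'.symm dzy.symm hφm hyA hzB).2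
  have r0 : sideSign a a' r = sideSign r a a' := by unfold sideSign; ring
  rw [r0] at ay az
  have ay := (pos_iff_pos_of_mul_pos ay).mp hma
  have az := (pos_iff_pos_of_mul_pos az).mp hma
  have zaa' : 0 < sideSign z a a' := by
    have : sideSign z a a' = sideSign a a' z := by unfold sideSign; ring
    linarith
  have zar : 0 < sideSign z a r := by
    have : sideSign z a r = - sideSign r a z := by unfold sideSign; ring
    linarith
  have zay : 0 < sideSign z a y := by
    have pl : sideSign z a y * sideSign r a a' =
        - sideSign r a z * sideSign a a' y + sideSign r a y * sideSign a a' z := by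
      unfold sideSign; ring
    have : 0 < sideSign z a y * sideSign r a a' := by
      rw [pl]
      exact add_pos (mul_pos (by linarith) ay) (mul_pos hspec az)
    exact (pos_iff_pos_of_mul_pos this).mpr hma
  have yzr : 0 < sideSign y z r * sideSign y z a := by
    have nz1 := gp_ne hgp py pz pr dzy.symm dyr dzr
    have nz2 := gp_ne hgp py pz pa dzy.symm dya dza
    by_contra hh
    have hh' := lt_of_le_of_ne (not_lt.mp hh) (mul_ne_zero nz1 nz2)
    have := seg_cross r a z y (mul_neg_of_neg_of_pos hzn hspec) (by
      rw [ss_swap y z, ss_swap y z, neg_mul_neg]; exact hh')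
    rw [hsg] at this
    exact Set.not_nonempty_empty this
  refine mk5 hgp φ a r a' y z pa pr pm py pz hr.symm (by rw [hφm]; exact hr)
    (by rw [hφm]; exact fun h => hyA h.symm) hcyc.symm hzB hma'.symm dyr.symm (dm z hzB)
    dya dzr hφm.symm ?_ ?_ ?_ ?_ ?_
  · rw [segment_symm ℝ a r]
    exact seg_disj _ _ _ _ (mul_pos hma hspec)
  · rw [Set.inter_comm]
    apply seg_disj
    have h1 : 0 < (sideSign y z r * sideSign y z a) * (sideSign y z a * sideSign y z a') :=
      mul_pos yzr yz
    have h2 : 0 < (sideSign y z r * sideSign y z a') * (sideSign y z a) ^ 2 := by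
      linarith [show (sideSign y z r * sideSign y z a') * (sideSign y z a) ^ 2 =
        (sideSign y z r * sideSign y z a) * (sideSign y z a * sideSign y z a') by ring]
    exact pos_of_mul_pos_left h2 (sq_nonneg _)
  · rw [Set.inter_comm]
    exact seg_disj _ _ _ _ (mul_pos zaa' zay)
  · rw [Set.inter_comm, segment_symm ℝ a r, segment_symm ℝ y z]
    exact hsg
  · exact seg_disj _ _ _ _ (mul_pos zar zaa')

/-- a geometric complete multipartite graph containing a non-rainbow plane cycle
contains a non-rainbow plane cycle of length 4 or of length 5. -/
theorem stmt_5 (P : Set Pt) (φ : Pt → ℕ) (hfin : P.Finite) (hgp : GenPos P)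
    (h : ∃ t : ℕ, ∃ γ : ZMod t → Pt, IsPlaneCycle φ t γ ∧ (∀ i, γ i ∈ P) ∧ NonRainbow φ t γ) :
    (∃ γ : ZMod 4 → Pt, IsPlaneCycle φ 4 γ ∧ (∀ i, γ i ∈ P) ∧ NonRainbow φ 4 γ) ∨
    (∃ γ : ZMod 5 → Pt, IsPlaneCycle φ 5 γ ∧ (∀ i, γ i ∈ P) ∧ NonRainbow φ 5 γ) := by
  classical
  by_cases hno : ∃ γ : ZMod 4 → Pt, IsPlaneCycle φ 4 γ ∧ (∀ i, γ i ∈ P) ∧ NonRainbow φ 4 γ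
  · exact Or.inl hno
  right
  obtain ⟨t, γ, hγ, hP, i1, j1, hij, hφ⟩ := h
  obtain ⟨ht, hinj, hcol, hseg⟩ := id hγ
  haveI : NeZero t := ⟨by omega⟩
  have z2 : (2 : ZMod t) ≠ 0 := by
    intro h3
    have h3 : ((2 : ℕ) : ZMod t) = 0 := by exact_mod_cast h3
    rw [ZMod.natCast_eq_zero_iff] at h3
    exact absurd (Nat.le_of_dvd (by norm_num) h3) (by omega)
  have hl : ∀ i, φ (γ (i - 1)) ≠ φ (γ i) := by
    intro i; have := hcol (i - 1); rwa [sub_add_cancel] at this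
  have hlr : ∀ i, γ (i + 1) ≠ γ (i - 1) := by
    intro i h; exact z2 (by linear_combination hinj h)
  set b0 := γ (i1 + 1) with hb0
  set b1 := γ (i1 - 1) with hb1
  have pb0 : b0 ∈ P := hP _
  have pb1 : b1 ∈ P := hP _
  have cb0 : φ b0 ≠ φ (γ i1) := (hcol i1).symm
  have cb1 : φ b1 ≠ φ (γ i1) := hl i1
  have db : b0 ≠ b1 := hlr i1
  let f : ZMod t → ℝ := fun i =>
    ((b1.1 - b0.1) * ((γ i).1 - b0.1) + (b1.2 - b0.2) * ((γ i).2 - b0.2)) / sideSign b0 b1 (γ i)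
  obtain ⟨i0, hi0, hmax⟩ := Finset.exists_max_image
    (Finset.univ.filter fun i => φ (γ i) = φ (γ i1)) f ⟨i1, by simp⟩
  simp only [Finset.mem_filter, Finset.mem_univ, true_and] at hi0 hmax
  have hpos0 : ∀ j, j ≠ i0 → φ (γ j) = φ (γ i0) → 0 < sideSign b0 (γ i0) (γ j) := by
    intro j hj hφj
    have hm := hmax j (hφj.trans hi0)
    have hs := (avoid hgp φ hno (hP i0) (hP j) pb0 pb1 (hinj.ne hj.symm) db hφj
      (by rw [hi0]; exact cb0) (by rw [hi0]; exact cb1)).2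
    have n0 : sideSign b0 (γ i0) (γ j) ≠ 0 := gp_ne hgp pb0 (hP i0) (hP j)
      (fun h => cb0 (by rw [h, hi0])) (fun h => cb0 (by rw [h, hφj, hi0])) (hinj.ne hj.symm)
    have hd : (f i0 - f j) * (sideSign b0 b1 (γ i0) * sideSign b0 b1 (γ j)) =
        ((b1.1 - b0.1) ^ 2 + (b1.2 - b0.2) ^ 2) * sideSign b0 (γ i0) (γ j) := by
      have q1 := left_ne_zero_of_mul hs.ne'
      have q2 := right_ne_zero_of_mul hs.ne'
      simp only [f]
      field_simp
      simp only [sideSign]; ring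
    have h1 : 0 ≤ (f i0 - f j) * (sideSign b0 b1 (γ i0) * sideSign b0 b1 (γ j)) :=
      mul_nonneg (by linarith) hs.le
    rw [hd] at h1
    have h2 : 0 < (b1.1 - b0.1) ^ 2 + (b1.2 - b0.2) ^ 2 := by
      by_contra hh
      apply db
      have e1 : (b1.1 - b0.1) = 0 := by nlinarith [sq_nonneg (b1.1 - b0.1), sq_nonneg (b1.2 - b0.2)]
      have e2 : (b1.2 - b0.2) = 0 := by nlinarith [sq_nonneg (b1.1 - b0.1), sq_nonneg (b1.2 - b0.2)]
      ext <;> linarith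
    exact lt_of_le_of_ne (nonneg_of_mul_nonneg_right h1 h2) n0.symm
  have hposb : ∀ b ∈ P, φ b ≠ φ (γ i0) → ∀ j, j ≠ i0 → φ (γ j) = φ (γ i0) →
      0 < sideSign b (γ i0) (γ j) := by
    intro b hb hφb j hj hφj
    have h0 := hpos0 j hj hφj
    by_cases hbb : b0 = b
    · rw [← hbb]; exact h0
    have hs := (avoid hgp φ hno (hP i0) (hP j) pb0 hb (hinj.ne hj.symm) hbb hφj
      (by rw [hi0]; exact cb0) hφb).1
    rw [ss_rot b0, ss_rot b] at hs
    exact (pos_iff_pos_of_mul_pos hs).mp h0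
  obtain ⟨m, hm, hφm⟩ : ∃ m, m ≠ i0 ∧ φ (γ m) = φ (γ i0) := by
    by_cases hh : i1 = i0
    · exact ⟨j1, by rw [← hh]; exact hij.symm, by rw [← hh, hφ]⟩
    · exact ⟨i1, hh, hi0.symm⟩
  have nn : sideSign (γ (i0 - 1)) (γ i0) (γ (i0 + 1)) ≠ 0 := by
    apply gp_ne hgp (hP _) (hP _) (hP _)
    · exact fun h => hl i0 (by rw [h])
    · exact (hlr i0).symm
    · exact fun h => hcol i0 (by rw [← h])
  rcases lt_or_gt_of_ne nn with hn | hn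
  · exact core hgp φ hno t γ hγ hP i0 m hm hφm (hposb _ (hP _) (hl i0)) hn
  · refine core hgp φ hno t (fun i => γ (-i)) (reverse_cycle hγ) (fun i => hP _) (-i0) (-m)
      (fun h => hm (neg_injective h)) (by simpa using hφm) ?_ ?_
    · intro j hj hφj
      have e1 : -(-i0 - 1) = i0 + 1 := by ring
      simp only [e1, neg_neg] at hφj ⊢
      exact hposb _ (hP _) (hcol i0).symm _ (fun h => hj (by rw [← h, neg_neg])) hφj
    · have e1 : -(-i0 - 1) = i0 + 1 := by ring
      have e2 : -(-i0 + 1) = i0 - 1 := by ring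
      simp only [e1, e2, neg_neg]
      have : sideSign (γ (i0 + 1)) (γ i0) (γ (i0 - 1)) =
        - sideSign (γ (i0 - 1)) (γ i0) (γ (i0 + 1)) := by unfold sideSign; ring
      linarith
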